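/- Let 𝒲 be a probability distribution over F₂-linear subspaces of F_{m,r} such that for every T ∈ Sym(m,r) and every subspace G₀ of F_{m,r}, P_{G∼𝒲}[G = G₀] = P_{G∼𝒲}[G = T(G₀)]. Then E_{G,G'∼𝒲 independent}[dist(G,G')] ≥ (2/9)·min( E_{G∼𝒲}[dim G], binom(m,r) − E_{G∼𝒲}[dim G] ). -/

import Mathlib

/-- Coefficient space of the degree-`r` part: `F_{m,r} ≅ F₂^{binom(m,r)}`,
with coordinates indexed by the `r`-element subsets of `[m]` (coefficients of the
squarefree monomials `x_I`, `|I| = r`). -/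
abbrev Coef (m r : ℕ) := {I : Finset (Fin m) // I.card = r} → ZMod 2

/-- The Boolean function `x ↦ ∑_I c_I ∏_{i ∈ I} x_i` determined by a full coefficient vector. -/
def evalC (m : ℕ) (c : Finset (Fin m) → ZMod 2) : (Fin m → ZMod 2) → ZMod 2 :=
  fun x => ∑ I : Finset (Fin m), c I * ∏ i ∈ I, x i

/-- The coefficient (in the multilinear expansion) of the monomial `x_I` of a Boolean
function `f`, via Möbius inversion over `F₂`: `c_I = ∑_{S ⊆ I} f(1_S)`. -/
def coefC (m : ℕ) (f : (Fin m → ZMod 2) → ZMod 2) : Finset (Fin m) → ZMod 2 :=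
  fun I => ∑ S ∈ I.powerset, f (fun i => if i ∈ S then 1 else 0)

/-- Extension of a degree-`r` coefficient vector to a full coefficient vector
(supported on the `r`-element subsets). -/
def degPart (m r : ℕ) (c : Coef m r) : Finset (Fin m) → ZMod 2 :=
  fun I => if h : I.card = r then c ⟨I, h⟩ else 0

/-- The map on degree-`r` coefficient vectors induced by the substitution `x ↦ Ax + b`:
substitute in the corresponding polynomial and keep only the degree-`r` coefficients. -/
def symMap (m r : ℕ) (A : Matrix (Fin m) (Fin m) (ZMod 2)) (b : Fin m → ZMod 2)
    (c : Coef m r) : Coef m r :=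
  fun J => coefC m (fun x => evalC m (degPart m r c) (A.mulVec x + b)) J.val

/-- `symMap` as an `F₂`-linear map. -/
noncomputable def symLin (m r : ℕ) (A : Matrix (Fin m) (Fin m) (ZMod 2)) (b : Fin m → ZMod 2) :
    Coef m r →ₗ[ZMod 2] Coef m r :=
  AddMonoidHom.toZModLinearMap 2 (AddMonoidHom.mk' (symMap m r A b) (by
    intro c c'
    funext J
    have h1 : degPart m r (c + c') = degPart m r c + degPart m r c' := by
      funext I; by_cases h : I.card = r <;> simp [degPart, h]
    have h2 : ∀ u v : Finset (Fin m) → ZMod 2, evalC m (u + v) = evalC m u + evalC m v := by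
      intro u v; funext x; simp [evalC, add_mul, Finset.sum_add_distrib]
    have h4 : ∀ f g : (Fin m → ZMod 2) → ZMod 2, coefC m (f + g) = coefC m f + coefC m g := by
      intro f g; funext I; simp [coefC, Finset.sum_add_distrib]
    show symMap m r A b (c + c') J = symMap m r A b c J + symMap m r A b c' J
    simp only [symMap, h1, h2]
    have : (fun x => (evalC m (degPart m r c) + evalC m (degPart m r c')) (A.mulVec x + b))
        = (fun x => evalC m (degPart m r c) (A.mulVec x + b))
          + (fun x => evalC m (degPart m r c') (A.mulVec x + b)) := rfl
    rw [this, h4]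
    rfl))

/-- The subspace distance `dist(A,B) = dim A + dim B - 2 dim (A ∩ B)`. -/
noncomputable def sdist {m r : ℕ} (G G' : Submodule (ZMod 2) (Coef m r)) : ℝ :=
  (Module.finrank (ZMod 2) G : ℝ) + (Module.finrank (ZMod 2) G' : ℝ)
    - 2 * (Module.finrank (ZMod 2) ↥(G ⊓ G') : ℝ)

/-- Möbius inversion: the only nonzero multilinear coefficient of `x_K` is the one at `K`. -/
lemma coefC_prod (m : ℕ) (K J : Finset (Fin m)) :
    coefC m (fun x => ∏ k ∈ K, x k) J = if K = J then 1 else 0 := by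
  have hprod : ∀ S : Finset (Fin m),
      (∏ k ∈ K, (if k ∈ S then (1 : ZMod 2) else 0)) = if K ⊆ S then 1 else 0 := fun S => by
    rw [Finset.prod_ite_zero]
    simp [Finset.subset_iff]
  have hfilter : J.powerset.filter (fun S => K ⊆ S) = Finset.Icc K J := by
    ext S
    simp [and_comm]
  simp only [coefC, hprod]
  rw [Finset.sum_boole, hfilter]
  by_cases hKJ : K ⊆ J
  · rw [Finset.card_Icc_finset hKJ]
    split_ifs with h
    · simp [h]
    · have hlt : K.card < J.card := Finset.card_lt_card (hKJ.ssubset_of_ne h)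
      obtain ⟨n, hn⟩ := Nat.exists_eq_add_of_lt hlt
      have h2 : (2 : ZMod 2) = 0 := by decide
      rw [hn, show K.card + n + 1 - K.card = n + 1 by omega]
      simp [h2]
  · have hne : K ≠ J := fun h => hKJ h.subset
    simp [Finset.Icc_eq_empty (fun h : K ≤ J => hKJ h), hne]

lemma degPart_coe (m r : ℕ) (c : Coef m r) (J : {I : Finset (Fin m) // I.card = r}) :
    degPart m r c J = c J := by
  simp [degPart, J.2]

/-- On Boolean points, substituting `x_i + x_j` for `x_i` in the monomial `x_I` adds to it the
monomial of `I` with `i` replaced by `j`, provided `i ∈ I`. -/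
lemma prod_transvection_mulVec {m : ℕ} (i j : Fin m) (I : Finset (Fin m))
    (x : Fin m → ZMod 2) :
    ∏ k ∈ I, (Matrix.transvection i j (1 : ZMod 2)).mulVec x k
      = ∏ k ∈ I, x k + if i ∈ I then ∏ k ∈ insert j (I.erase i), x k else 0 := by
  have hval : ∀ k, (Matrix.transvection i j (1 : ZMod 2)).mulVec x k
      = x k + if k = i then x j else 0 := fun k => by
    simp [Matrix.transvection, Matrix.add_mulVec, Matrix.single_mulVec, Function.update_apply]
  have hoff : ∀ K : Finset (Fin m), i ∉ K →
      ∏ k ∈ K, (x k + if k = i then x j else 0) = ∏ k ∈ K, x k := fun K hK =>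
    Finset.prod_congr rfl fun k hk => by
      simp [show k ≠ i from fun h => hK (h ▸ hk)]
  simp only [hval]
  split_ifs with hi
  · rw [← Finset.mul_prod_erase I _ hi, hoff _ (Finset.notMem_erase i I),
      ← Finset.mul_prod_erase I x hi]
    have hidem : ∀ a : ZMod 2, a * a = a := by decide
    by_cases hj : j ∈ I.erase i
    · rw [Finset.insert_eq_self.2 hj, ← Finset.mul_prod_erase (I.erase i) x hj]
      simp only [if_true, add_mul, ← mul_assoc, hidem]
    · rw [Finset.prod_insert hj]
      simp [add_mul]
  · simpa using hoff I hi

/-- Replacing `i` by `j` in `I` and replacing `j` by `i` in `J` are mutually inverse. -/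
lemma exchange_eq_iff {α : Type*} [DecidableEq α] {i j : α} (hij : i ≠ j) {I J : Finset α}
    (hcard : I.card = J.card) :
    (i ∈ I ∧ insert j (I.erase i) = J) ↔ ((j ∈ J ∧ i ∉ J) ∧ I = insert i (J.erase j)) := by
  constructor
  · rintro ⟨hi, rfl⟩
    have hj : j ∉ I.erase i := fun h => by
      rw [Finset.insert_eq_self.2 h] at hcard
      have := Finset.card_erase_lt_of_mem hi
      omega
    refine ⟨by simp [hij], ?_⟩
    rw [Finset.erase_insert hj, Finset.insert_erase hi]
  · rintro ⟨⟨hj, hi⟩, rfl⟩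
    refine ⟨by simp, ?_⟩
    rw [Finset.erase_insert (by simp [hi]), Finset.insert_erase hj]

/-- The transvection `x_i ↦ x_i + x_j` acts on degree-`r` coefficients by adding the shift that
replaces `i` by `j`. -/
lemma symLin_transvection_apply {m r : ℕ} {i j : Fin m} (hij : i ≠ j) (c : Coef m r)
    (J : {I : Finset (Fin m) // I.card = r}) :
    symLin m r (Matrix.transvection i j 1) 0 c J
      = c J + if j ∈ J.1 ∧ i ∉ J.1 then degPart m r c (insert i (J.1.erase j)) else 0 := by
  have hexpand : symLin m r (Matrix.transvection i j 1) 0 c J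
      = ∑ I : Finset (Fin m), degPart m r c I *
          (coefC m (fun x => ∏ k ∈ I, x k) J.1
            + if i ∈ I then coefC m (fun x => ∏ k ∈ insert j (I.erase i), x k) J.1 else 0) := by
    change coefC m (fun x => evalC m (degPart m r c)
      ((Matrix.transvection i j 1).mulVec x + 0)) J.1 = _
    simp only [coefC, evalC, add_zero, prod_transvection_mulVec]
    rw [Finset.sum_comm]
    refine Finset.sum_congr rfl fun I _ => ?_
    rw [← Finset.mul_sum, Finset.sum_add_distrib]
    split_ifs <;> simp
  rw [hexpand]
  simp only [coefC_prod, mul_add, Finset.sum_add_distrib]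
  congr 1
  · simp [degPart_coe]
  · have hterm : ∀ I : Finset (Fin m),
        (degPart m r c I * if i ∈ I then (if insert j (I.erase i) = J.1 then 1 else 0) else 0)
          = if I = insert i (J.1.erase j) then
              (if j ∈ J.1 ∧ i ∉ J.1 then degPart m r c I else 0) else 0 := fun I => by
      by_cases hI : I.card = r
      · have := exchange_eq_iff hij (hI.trans J.2.symm)
        split_ifs <;> simp <;> tauto
      · simp [degPart, hI]
    simp [hterm]

lemma symLin_transvection_involutive {m r : ℕ} {i j : Fin m} (hij : i ≠ j) :
    Function.Involutive (symLin m r (Matrix.transvection i j 1) 0) := fun c => by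
  have h2 : ∀ a b : ZMod 2, a + b + b = a := by decide
  funext J
  have hshift : degPart m r (symLin m r (Matrix.transvection i j 1) 0 c) (insert i (J.1.erase j))
      = degPart m r c (insert i (J.1.erase j)) := by
    unfold degPart
    split_ifs
    · simp [symLin_transvection_apply hij]
    · rfl
  rw [symLin_transvection_apply hij, hshift, symLin_transvection_apply hij, h2]

section Irreducible

variable {m r : ℕ} {U : Submodule (ZMod 2) (Coef m r)}

/-- A transvection-invariant subspace is closed under replacing `i` by `j` in all monomials
where this is possible and killing the others. -/
lemma exists_mem_shift
    (hU : ∀ i j : Fin m, i ≠ j → ∀ c ∈ U, symLin m r (Matrix.transvection i j 1) 0 c ∈ U)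
    {i j : Fin m} (hij : i ≠ j) {c : Coef m r} (hc : c ∈ U) :
    ∃ d ∈ U, ∀ J : {I : Finset (Fin m) // I.card = r},
      d J = if j ∈ J.1 ∧ i ∉ J.1 then degPart m r c (insert i (J.1.erase j)) else 0 :=
  ⟨_, U.sub_mem (hU i j hij c hc) hc, fun J => by
    simp [symLin_transvection_apply hij]⟩

/-- A transvection-invariant subspace is closed under the projection to the span of the monomials
containing `i` and not `j`. -/
lemma exists_mem_restrict
    (hU : ∀ i j : Fin m, i ≠ j → ∀ c ∈ U, symLin m r (Matrix.transvection i j 1) 0 c ∈ U)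
    {i j : Fin m} (hij : i ≠ j) {c : Coef m r} (hc : c ∈ U) :
    ∃ d ∈ U, ∀ J : {I : Finset (Fin m) // I.card = r},
      d J = if i ∈ J.1 ∧ j ∉ J.1 then c J else 0 := by
  obtain ⟨d, hd, hdval⟩ := exists_mem_shift hU hij hc
  obtain ⟨e, he, heval⟩ := exists_mem_shift hU hij.symm hd
  refine ⟨e, he, fun J => ?_⟩
  rw [heval]
  refine if_ctx_congr Iff.rfl (fun h => ?_) fun _ => rfl
  obtain ⟨hi, hj⟩ := h
  have hj' : j ∉ J.1.erase i := by simp [hj]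
  have hcard : (insert j (J.1.erase i)).card = r := by
    rw [Finset.card_insert_of_notMem hj', Finset.card_erase_add_one hi, J.2]
  rw [← degPart_coe m r c, degPart, dif_pos hcard, hdval]
  simp only [Finset.erase_insert hj', Finset.insert_erase hi]
  simp [hij, degPart]

lemma exists_mem_diff_of_ne (I J : {I : Finset (Fin m) // I.card = r}) (h : I ≠ J) :
    ∃ i ∈ I.1, i ∉ J.1 := by
  by_contra! hsub
  exact h (Subtype.ext (Finset.eq_of_subset_of_card_le hsub (by rw [I.2, J.2])))

/-- A nonzero transvection-invariant subspace contains a monomial. -/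
lemma exists_single_mem
    (hU : ∀ i j : Fin m, i ≠ j → ∀ c ∈ U, symLin m r (Matrix.transvection i j 1) 0 c ∈ U)
    (hne : U ≠ ⊥) : ∃ I, Pi.single I (1 : ZMod 2) ∈ U := by
  obtain ⟨c₀, hc₀, hc₀ne⟩ := U.ne_bot_iff.1 hne
  obtain ⟨I, hI⟩ := Function.ne_iff.1 hc₀ne
  let supp : Coef m r → Finset {I : Finset (Fin m) // I.card = r} := fun c => {J | c J ≠ 0}
  obtain ⟨c, ⟨hc, hcI⟩, hmin⟩ :=
    exists_minimalFor_of_wellFoundedLT (fun c => c ∈ U ∧ c I ≠ 0) supp ⟨c₀, hc₀, hI⟩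
  have hone : ∀ a : ZMod 2, a ≠ 0 → a = 1 := by decide
  refine ⟨I, ?_⟩
  convert hc using 1
  funext J
  by_cases hJI : J = I
  · subst hJI
    simp [hone _ hcI]
  rw [Pi.single_eq_of_ne hJI]
  by_contra hcJ
  obtain ⟨i, hi, hiJ⟩ := exists_mem_diff_of_ne I J (Ne.symm hJI)
  obtain ⟨j, hj, hjI⟩ := exists_mem_diff_of_ne J I hJI
  obtain ⟨d, hd, hdval⟩ := exists_mem_restrict hU (fun h : i = j => hiJ (h ▸ hj)) hc
  have hdI : d I ≠ 0 := by simpa [hdval, hi, hjI] using hcI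
  have hsub : supp d ⊆ supp c := fun K hK => by
    simp only [supp, Finset.mem_filter, Finset.mem_univ, true_and, hdval] at hK ⊢
    exact fun h => hK (by simp [h])
  have hmem : J ∈ supp d := hmin ⟨hd, hdI⟩ hsub (by simpa [supp] using Ne.symm hcJ)
  simp [supp, hdval, hiJ] at hmem

/-- A transvection-invariant subspace containing one monomial contains all of them. -/
lemma single_mem_of_single_mem
    (hU : ∀ i j : Fin m, i ≠ j → ∀ c ∈ U, symLin m r (Matrix.transvection i j 1) 0 c ∈ U)
    (I J : {I : Finset (Fin m) // I.card = r}) (hI : Pi.single I (1 : ZMod 2) ∈ U) :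
    Pi.single J (1 : ZMod 2) ∈ U := by
  induction hn : (I.1 \ J.1).card using Nat.strong_induction_on generalizing I with
  | _ n ih =>
    by_cases hIJ : I = J
    · exact hIJ ▸ hI
    obtain ⟨i, hi, hiJ⟩ := exists_mem_diff_of_ne I J hIJ
    obtain ⟨j, hj, hjI⟩ := exists_mem_diff_of_ne J I (Ne.symm hIJ)
    have hij : i ≠ j := fun h => hiJ (h ▸ hj)
    have hjI' : j ∉ I.1.erase i := by simp [hjI]
    have hcard : (insert j (I.1.erase i)).card = r := by
      rw [Finset.card_insert_of_notMem hjI', Finset.card_erase_add_one hi, I.2]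
    obtain ⟨d, hd, hdval⟩ := exists_mem_shift hU hij hI
    refine ih _ ?_ ⟨insert j (I.1.erase i), hcard⟩ ?_ rfl
    · rw [← hn]
      refine Finset.card_lt_card (Finset.ssubset_iff_of_subset ?_ |>.2
        ⟨i, by simp [hi, hiJ], by simp [hij]⟩)
      intro k
      simp only [Finset.mem_sdiff, Finset.mem_insert, Finset.mem_erase]
      rintro ⟨rfl | hk, hkJ⟩
      · exact absurd hj hkJ
      · exact ⟨hk.2, hkJ⟩
    · convert hd using 1
      funext K
      have hiff := exchange_eq_iff hij (I.2.trans K.2.symm)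
      simp only [hdval, Pi.single_apply, degPart, Subtype.ext_iff]
      split_ifs <;> grind

/-- The action of the transvections on the degree-`r` part is irreducible. -/
lemma eq_bot_or_eq_top_of_transvection_invariant
    (hU : ∀ i j : Fin m, i ≠ j → ∀ c ∈ U, symLin m r (Matrix.transvection i j 1) 0 c ∈ U) :
    U = ⊥ ∨ U = ⊤ := by
  refine or_iff_not_imp_left.2 fun hne => ?_
  obtain ⟨I, hI⟩ := exists_single_mem hU hne
  rw [eq_top_iff, ← (Pi.basisFun (ZMod 2) {I : Finset (Fin m) // I.card = r}).span_eq,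
    Submodule.span_le]
  rintro _ ⟨J, rfl⟩
  simpa using single_mem_of_single_mem hU I J hI

end Irreducible

section Distance

variable {m r : ℕ}

lemma sdist_map (e : Coef m r ≃ₗ[ZMod 2] Coef m r) (G A : Submodule (ZMod 2) (Coef m r)) :
    sdist (G.map e.toLinearMap) (A.map e.toLinearMap) = sdist G A := by
  simp only [sdist]
  rw [← Submodule.map_inf _ e.injective]
  simp only [LinearEquiv.finrank_map_eq]

/-- The distance to a fixed subspace is submodular. -/
lemma sdist_sup_add_sdist_inf_le (G A B : Submodule (ZMod 2) (Coef m r)) :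
    sdist G (A ⊔ B) + sdist G (A ⊓ B) ≤ sdist G A + sdist G B := by
  have h1 := Submodule.finrank_sup_add_finrank_inf_eq A B
  have h2 := Submodule.finrank_sup_add_finrank_inf_eq (G ⊓ A) (G ⊓ B)
  have h3 : Module.finrank (ZMod 2) ↥(G ⊓ A ⊔ G ⊓ B)
      ≤ Module.finrank (ZMod 2) ↥(G ⊓ (A ⊔ B)) := Submodule.finrank_mono le_inf_sup
  rw [← inf_inf_distrib_left] at h2
  simp only [sdist]
  rify at h1 h2 h3
  linarith

lemma sdist_bot (G : Submodule (ZMod 2) (Coef m r)) :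
    sdist G ⊥ = Module.finrank (ZMod 2) G := by
  simp [sdist]

lemma finrank_coef (m r : ℕ) : Module.finrank (ZMod 2) (Coef m r) = m.choose r := by
  simp [Fintype.card_finset_len]

lemma sdist_top (G : Submodule (ZMod 2) (Coef m r)) :
    sdist G ⊤ = m.choose r - Module.finrank (ZMod 2) G := by
  rw [sdist, inf_top_eq, finrank_top, finrank_coef]
  ring

end Distance

/-- A submodular function on a finite lattice attains its minimum at a point that is fixed by every
involutive order automorphism preserving the function. -/
lemma exists_min_fixed_of_submodular {L : Type*} [Lattice L] [Finite L] [Nonempty L]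
    (f : L → ℝ) (hsub : ∀ a b, f (a ⊔ b) + f (a ⊓ b) ≤ f a + f b) :
    ∃ a, (∀ b, f a ≤ f b) ∧
      ∀ φ : L → L, Monotone φ → Function.Involutive φ → (∀ b, f (φ b) = f b) → φ a = a := by
  obtain ⟨a₀, ha₀⟩ := Finite.exists_min f
  obtain ⟨a, -, ha⟩ := Set.Finite.exists_le_minimal (Set.toFinite {a | ∀ b, f a ≤ f b}) ha₀
  refine ⟨a, ha.prop, fun φ hmono hinv hf => ?_⟩
  have hinf : ∀ b, f (a ⊓ φ a) ≤ f b := fun b => by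
    have h1 := hsub a (φ a)
    have h2 := ha.prop (a ⊔ φ a)
    have h3 := ha.prop b
    rw [hf] at h1
    linarith
  have hle : a ≤ φ a := inf_eq_left.1 (inf_le_left.antisymm (ha.le_of_le hinf inf_le_left))
  exact le_antisymm ((hmono hle).trans_eq (hinv a)) hle

/-- The distance of an invariant random subspace to any fixed subspace is on average at least
the one to `⊥` or to `⊤`. -/
lemma min_le_sum_sdist (m r : ℕ) [Fintype (Submodule (ZMod 2) (Coef m r))]
    (w : Submodule (ZMod 2) (Coef m r) → ℝ) (hw : ∀ G, 0 ≤ w G)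
    (hinv : ∀ i j : Fin m, i ≠ j → ∀ G,
      w (G.map (symLin m r (Matrix.transvection i j 1) 0)) = w G)
    (A : Submodule (ZMod 2) (Coef m r)) :
    min (∑ G, w G * sdist G ⊥) (∑ G, w G * sdist G ⊤) ≤ ∑ G, w G * sdist G A := by
  obtain ⟨U, hmin, hfix⟩ := exists_min_fixed_of_submodular
    (fun A : Submodule (ZMod 2) (Coef m r) => ∑ G, w G * sdist G A) (fun A B => by
      simp only [← Finset.sum_add_distrib, ← mul_add]
      exact Finset.sum_le_sum fun G _ =>
        mul_le_mul_of_nonneg_left (sdist_sup_add_sdist_inf_le G A B) (hw G))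
  have hU : U = ⊥ ∨ U = ⊤ := by
    refine eq_bot_or_eq_top_of_transvection_invariant fun i j hij c hc => ?_
    set T := symLin m r (Matrix.transvection i j 1) 0
    have hTT : Function.Involutive T := symLin_transvection_involutive hij
    have hmap : Function.Involutive (Submodule.map T) := fun G => by
      rw [← Submodule.map_comp, show T ∘ₗ T = LinearMap.id from LinearMap.ext hTT,
        Submodule.map_id]
    have hTU : U.map T = U := by
      refine hfix _ (fun _ _ h => Submodule.map_mono h) hmap fun B => ?_
      rw [← Equiv.sum_comp hmap.toPerm]
      refine Finset.sum_congr rfl fun G _ => ?_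
      rw [Function.Involutive.coe_toPerm, hinv i j hij]
      congr 1
      exact sdist_map (LinearEquiv.ofInvolutive T hTT) G B
    rw [← hTU]
    exact Submodule.mem_map_of_mem hc
  rcases hU with rfl | rfl
  · exact (min_le_left _ _).trans (hmin A)
  · exact (min_le_right _ _).trans (hmin A)

/-- if a probability distribution `𝒲` on subspaces of `F_{m,r}` is invariant
under every `π ∈ Sym(m,r)` (induced by invertible affine substitutions), then
`E_{G,G' ∼ 𝒲 indep}[dist(G,G')] ≥ (2/9) · min(E[dim G], binom(m,r) - E[dim G])`. -/
theorem stmt6 (m r : ℕ) (𝒲 : PMF (Submodule (ZMod 2) (Coef m r)))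
    (hinv : ∀ A : Matrix (Fin m) (Fin m) (ZMod 2), IsUnit A → ∀ b : Fin m → ZMod 2,
      ∀ G₀ : Submodule (ZMod 2) (Coef m r), 𝒲 (Submodule.map (symLin m r A b) G₀) = 𝒲 G₀) :
    (∑' p : Submodule (ZMod 2) (Coef m r) × Submodule (ZMod 2) (Coef m r),
        (𝒲 p.1).toReal * (𝒲 p.2).toReal * sdist p.1 p.2)
      ≥ (2 / 9) *
        min (∑' G : Submodule (ZMod 2) (Coef m r), (𝒲 G).toReal * (Module.finrank (ZMod 2) G : ℝ))
          ((m.choose r : ℝ)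
            - ∑' G : Submodule (ZMod 2) (Coef m r), (𝒲 G).toReal * (Module.finrank (ZMod 2) G : ℝ)) := by
  have : Fintype (Submodule (ZMod 2) (Coef m r)) := Fintype.ofFinite _
  simp only [tsum_fintype]
  set w : Submodule (ZMod 2) (Coef m r) → ℝ := fun G => (𝒲 G).toReal with hwdef
  have hw : ∀ G, 0 ≤ w G := fun G => ENNReal.toReal_nonneg
  have hsum : ∑ G, w G = 1 := by
    have htsum := 𝒲.tsum_coe
    rw [tsum_fintype] at htsum
    rw [← ENNReal.toReal_sum fun G _ => 𝒲.apply_ne_top G, htsum, ENNReal.toReal_one]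
  have hbot : ∑ G, w G * sdist G ⊥ = ∑ G, w G * (Module.finrank (ZMod 2) G : ℝ) := by
    simp only [sdist_bot]
  have htop : ∑ G, w G * sdist G ⊤
      = (m.choose r : ℝ) - ∑ G, w G * (Module.finrank (ZMod 2) G : ℝ) := by
    simp only [sdist_top, mul_sub, Finset.sum_sub_distrib, ← Finset.sum_mul, hsum, one_mul]
  have hnonneg : 0 ≤ min (∑ G, w G * sdist G ⊥) (∑ G, w G * sdist G ⊤) := by
    refine le_min (Finset.sum_nonneg fun G _ => mul_nonneg (hw G) ?_)
      (Finset.sum_nonneg fun G _ => mul_nonneg (hw G) ?_)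
    · rw [sdist_bot]
      positivity
    · rw [sdist_top, sub_nonneg, ← finrank_coef]
      exact_mod_cast Submodule.finrank_le G
  have hmin := min_le_sum_sdist m r w hw fun i j hij G => by
    rw [hwdef]
    dsimp only
    rw [hinv _ ((Matrix.isUnit_iff_isUnit_det _).2
      (by rw [Matrix.det_transvection_of_ne i j hij]; exact isUnit_one))]
  have hpairs : ∑ p : Submodule (ZMod 2) (Coef m r) × Submodule (ZMod 2) (Coef m r),
      w p.1 * w p.2 * sdist p.1 p.2 = ∑ A, w A * ∑ G, w G * sdist G A := by
    rw [Fintype.sum_prod_type_right]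
    refine Finset.sum_congr rfl fun A _ => ?_
    rw [Finset.mul_sum]
    exact Finset.sum_congr rfl fun G _ => by ring
  change _ ≤ ∑ p : Submodule (ZMod 2) (Coef m r) × Submodule (ZMod 2) (Coef m r),
      w p.1 * w p.2 * sdist p.1 p.2
  rw [hpairs, ← htop, ← hbot]
  calc _ ≤ min (∑ G, w G * sdist G ⊥) (∑ G, w G * sdist G ⊤) := by linarith
    _ = ∑ A, w A * min (∑ G, w G * sdist G ⊥) (∑ G, w G * sdist G ⊤) := by
      rw [← Finset.sum_mul, hsum, one_mul]
    _ ≤ _ := Finset.sum_le_sum fun A _ => mul_le_mul_of_nonneg_left (hmin A) (hw A)
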